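/- Let N ≥ 2. In M_{2N}(ℂ)⊗M_{2N}(ℂ) define σ = 2 e_{1,N+1}, M = 1_{2N} − e_{1,N+1} (note M² = (1_{2N} + E_{1+1})^{−1} and σ = ln(1_{2N} + E_{1+1}) since E_{1+1}² = 0), X_i = E_{1−i} ⊗ (E_{1+i} M) for 2 ≤ i ≤ N, and let F = (1⊗1 + X_N)(1⊗1 + X_{N−1}) ⋯ (1⊗1 + X_2)(1⊗1 + H_{11}⊗σ) be the image of the full extended jordanian twist F_{E₁} in the defining representation of sp(N,ℂ). Then F is invertible, and R = τ(F) · F^{−1} satisfies the quantum Yang–Baxter equation R₁₂R₁₃R₂₃ = R₂₃R₁₃R₁₂ in M_{2N}(ℂ)⊗M_{2N}(ℂ)⊗M_{2N}(ℂ), together with the triangularity condition R · τ(R) = 1⊗1. -/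

import Mathlib

/- Matrix units `e_{a,b}` of `M_{2N}(ℂ)`, with 1-based indices `1 ≤ a, b ≤ 2N`
   (out-of-range indices give the zero matrix). -/
noncomputable def eM (N a b : ℕ) : Matrix (Fin (2*N)) (Fin (2*N)) ℂ :=
  Matrix.of fun p q => if p.val + 1 = a ∧ q.val + 1 = b then 1 else 0

/-- `H_{kk} = (1/2)(e_{k,k} - e_{N+k,N+k})`, `1 ≤ k ≤ N`. -/
noncomputable def Hgen (N k : ℕ) : Matrix (Fin (2*N)) (Fin (2*N)) ℂ :=
  (1/2 : ℂ) • (eM N k k - eM N (N+k) (N+k))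

/-- `E_{k+i} = e_{k,N+i} + e_{i,N+k}` (so `E_{k+k} = 2 e_{k,N+k}`), `1 ≤ k ≤ i ≤ N`. -/
noncomputable def Ep (N k i : ℕ) : Matrix (Fin (2*N)) (Fin (2*N)) ℂ :=
  eM N k (N+i) + eM N i (N+k)

/-- `E_{k−i} = e_{k,i} - e_{N+i,N+k}`, `1 ≤ k < i ≤ N`. -/
noncomputable def Em (N k i : ℕ) : Matrix (Fin (2*N)) (Fin (2*N)) ℂ :=
  eM N k i - eM N (N+i) (N+k)

open TensorProduct

/-- `r₁₂ : x ⊗ y ↦ (x ⊗ y) ⊗ 1`. -/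
noncomputable def emb12 (A : Type) [Ring A] [Algebra ℂ A] :
    (A ⊗[ℂ] A) →ₐ[ℂ] (A ⊗[ℂ] A) ⊗[ℂ] A :=
  Algebra.TensorProduct.includeLeft

/-- `r₁₃ : x ⊗ y ↦ (x ⊗ 1) ⊗ y`. -/
noncomputable def emb13 (A : Type) [Ring A] [Algebra ℂ A] :
    (A ⊗[ℂ] A) →ₐ[ℂ] (A ⊗[ℂ] A) ⊗[ℂ] A :=
  Algebra.TensorProduct.map Algebra.TensorProduct.includeLeft (AlgHom.id ℂ A)

/-- `r₂₃ : x ⊗ y ↦ (1 ⊗ x) ⊗ y`. -/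
noncomputable def emb23 (A : Type) [Ring A] [Algebra ℂ A] :
    (A ⊗[ℂ] A) →ₐ[ℂ] (A ⊗[ℂ] A) ⊗[ℂ] A :=
  Algebra.TensorProduct.map Algebra.TensorProduct.includeRight (AlgHom.id ℂ A)

/-- The classical Yang–Baxter equation `[r₁₂,r₁₃] + [r₁₂,r₂₃] + [r₁₃,r₂₃] = 0`,
with the commutator bracket `[X,Y] = XY − YX`. -/
def CYBE (A : Type) [Ring A] [Algebra ℂ A] (r : A ⊗[ℂ] A) : Prop :=
  (emb12 A r * emb13 A r - emb13 A r * emb12 A r) +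
  (emb12 A r * emb23 A r - emb23 A r * emb12 A r) +
  (emb13 A r * emb23 A r - emb23 A r * emb13 A r) = 0

/-- `x ∧ y := x ⊗ y − y ⊗ x`. -/
noncomputable def wedge {A : Type} [Ring A] [Algebra ℂ A] (x y : A) : A ⊗[ℂ] A :=
  x ⊗ₜ[ℂ] y - y ⊗ₜ[ℂ] x

/-- `M_{2N}(ℂ)`. -/
abbrev MatN (N : ℕ) := Matrix (Fin (2*N)) (Fin (2*N)) ℂ


/-- The exponentials of a solution `(a, b, c)` of the classical Yang–Baxter equation satisfy the quantum
Yang–Baxter equation when all terms of degree at least four vanish; `p`, `q`, `s` are the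
halves of the squares of `a`, `b`, `c`. -/
theorem yangBaxter_of_classical {B : Type*} [Ring B] [Algebra ℂ B] {a b c p q s t : B}
    (hcl : (a * b - b * a) + (a * c - c * a) + (b * c - c * b) = 0)
    (haa : a * a = p + p) (hbb : b * b = q + q) (hcc : c * c = s + s)
    (hpb : p * b = t) (haq : a * q = -t) (hcq : c * q = t)
    (hbs : b * s = t) (hsb : s * b = -t)
    (hat : a * t = 0) (hct : c * t = 0)
    (hpq : p * q = 0) (hqp : q * p = 0) (hps : p * s = 0) (hsp : s * p = 0)
    (hqs : q * s = 0) (hsq : s * q = 0) (hbp : b * p = -t) :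
    (1 + a + p) * (1 + b + q) * (1 + c + s) = (1 + c + s) * (1 + b + q) * (1 + a + p) := by
  have hdeg3 : a * b * c - c * b * a + (p * b - b * p) + (p * c - c * p) + (a * q - q * a)
      + (q * c - c * q) + (a * s - s * a) + (b * s - s * b) = 0 := by
    have h2 : (2 : ℂ) • (a * b * c - c * b * a + (p * b - b * p) + (p * c - c * p)
        + (a * q - q * a) + (q * c - c * q) + (a * s - s * a) + (b * s - s * b)) = 0 := by
      rw [two_smul]
      linear_combination (norm := noncomm_ring) a * hcl + hcl * a + b * hcl + hcl * b + c * hcl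
        + hcl * c - haa * b + b * haa - haa * c + c * haa - a * hbb + hbb * a - hbb * c + c * hbb
        - a * hcc + hcc * a - b * hcc + hcc * b
    exact (smul_eq_zero_iff_right two_ne_zero).mp h2
  linear_combination (norm := noncomm_ring) hcl + hdeg3
    + hpb * (c + s) + haq * (c + s) + a * hbs + hat
    + hpq * (1 + c + s) + hps + hqs
    - hcq * (a + p) - hsb * (a + p) - c * hbp + hct - hsq * (1 + a + p)
    - hsp - hqp

section Extended

variable {A : Type} [Ring A] [Algebra ℂ A] {ι : Type} [Fintype ι]

/-- The relations satisfied by the images of the generators of the extended jordanian twist: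
`x i`, `y i` stand for `E_{1-i}`, `E_{1+i}`, `e` for half of `E_{1+1}`, and `h` for `H_{11}`. -/
structure ExtendedRelations [DecidableEq ι] (x y : ι → A) (e h : A) : Prop where
  xx : ∀ i j, x i * x j = 0
  yy : ∀ i j, y i * y j = 0
  xy : ∀ i j, x i * y j = if i = j then e else 0
  yx : ∀ i j, y i * x j = if i = j then -e else 0
  ex : ∀ i, e * x i = 0
  xe : ∀ i, x i * e = 0
  ey : ∀ i, e * y i = 0
  ye : ∀ i, y i * e = 0
  ee : e * e = 0
  he : h * e = (1 / 2 : ℂ) • e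
  eh : e * h = -((1 / 2 : ℂ) • e)
  hx : ∀ i, h * x i = x i * h + (1 / 2 : ℂ) • x i
  hy : ∀ i, h * y i = y i * h + (1 / 2 : ℂ) • y i

/-- The nilpotent part of the extended jordanian twist. -/
noncomputable def twistPart (x y : ι → A) (e h : A) : A ⊗[ℂ] A :=
  ∑ i, x i ⊗ₜ[ℂ] y i + (2 : ℂ) • (h ⊗ₜ[ℂ] e)

/-- The classical `r`-matrix of the extended jordanian twist. -/
noncomputable def extendedR (x y : ι → A) (e h : A) : A ⊗[ℂ] A :=
  ∑ i, wedge (y i) (x i) + (2 : ℂ) • wedge e h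

/-- The left-hand side of the classical Yang–Baxter equation, polarized. -/
noncomputable def cybeForm (r s : A ⊗[ℂ] A) : (A ⊗[ℂ] A) ⊗[ℂ] A :=
  (emb12 A r * emb13 A s - emb13 A s * emb12 A r) +
  (emb12 A r * emb23 A s - emb23 A s * emb12 A r) +
  (emb13 A r * emb23 A s - emb23 A s * emb13 A r)

theorem tensorComm_tensorComm (z : A ⊗[ℂ] A) :
    Algebra.TensorProduct.comm ℂ A A (Algebra.TensorProduct.comm ℂ A A z) = z :=
  (Algebra.TensorProduct.comm ℂ A A).symm_apply_apply z

theorem emb12_tmul (a b : A) : emb12 A (a ⊗ₜ[ℂ] b) = (a ⊗ₜ[ℂ] b) ⊗ₜ[ℂ] (1 : A) := rfl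

theorem emb13_tmul (a b : A) : emb13 A (a ⊗ₜ[ℂ] b) = (a ⊗ₜ[ℂ] (1 : A)) ⊗ₜ[ℂ] b := by
  simp [emb13]

theorem emb23_tmul (a b : A) : emb23 A (a ⊗ₜ[ℂ] b) = ((1 : A) ⊗ₜ[ℂ] a) ⊗ₜ[ℂ] b := by
  simp [emb23]

theorem extendedR_eq_comm_sub (x y : ι → A) (e h : A) : extendedR x y e h =
    Algebra.TensorProduct.comm ℂ A A (twistPart x y e h) - twistPart x y e h := by
  simp only [extendedR, twistPart, wedge, map_add, map_sum, map_smul,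
    Algebra.TensorProduct.comm_tmul, Finset.sum_sub_distrib]
  module

/-- The obstruction to the Heisenberg part of `extendedR` solving the classical Yang–Baxter
equation, up to the factor `-2`. -/
noncomputable def obstruction (x y : ι → A) (e : A) : (A ⊗[ℂ] A) ⊗[ℂ] A :=
  ∑ i, ((e ⊗ₜ[ℂ] y i) ⊗ₜ[ℂ] x i - (e ⊗ₜ[ℂ] x i) ⊗ₜ[ℂ] y i
    - (y i ⊗ₜ[ℂ] e) ⊗ₜ[ℂ] x i + (x i ⊗ₜ[ℂ] e) ⊗ₜ[ℂ] y i
    + (y i ⊗ₜ[ℂ] x i) ⊗ₜ[ℂ] e - (x i ⊗ₜ[ℂ] y i) ⊗ₜ[ℂ] e)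

namespace ExtendedRelations

variable [DecidableEq ι] {x y : ι → A} {e h : A}

theorem cybeForm_heisenberg (rel : ExtendedRelations x y e h) :
    cybeForm (∑ i, wedge (y i) (x i)) (∑ i, wedge (y i) (x i)) =
      -(obstruction x y e + obstruction x y e) := by
  simp only [cybeForm, obstruction, wedge, map_sum, map_sub, emb12_tmul, emb13_tmul, emb23_tmul,
    Finset.sum_mul, Finset.mul_sum, mul_sub, sub_mul, Algebra.TensorProduct.tmul_mul_tmul, one_mul, mul_one,
    rel.xx, rel.yy, rel.xy, rel.yx, TensorProduct.ite_tmul, TensorProduct.tmul_ite,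
    TensorProduct.zero_tmul, TensorProduct.tmul_zero, TensorProduct.neg_tmul,
    TensorProduct.tmul_neg, Finset.sum_sub_distrib, Finset.sum_add_distrib,
    Finset.sum_ite_eq', Finset.sum_neg_distrib, Finset.mem_univ, if_true, Finset.sum_const_zero]
  abel

theorem cybeForm_cross (rel : ExtendedRelations x y e h) :
    cybeForm (∑ i, wedge (y i) (x i)) (wedge e h) + cybeForm (wedge e h) (∑ i, wedge (y i) (x i)) =
      obstruction x y e := by
  simp only [cybeForm, obstruction, wedge, map_sum, map_sub, emb12_tmul, emb13_tmul, emb23_tmul,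
    Finset.sum_mul, Finset.mul_sum, mul_sub, sub_mul, Algebra.TensorProduct.tmul_mul_tmul, one_mul, mul_one,
    rel.ex, rel.ey, rel.xe, rel.ye, rel.hx, rel.hy, TensorProduct.zero_tmul,
    TensorProduct.tmul_zero, TensorProduct.add_tmul, TensorProduct.tmul_add,
    ← TensorProduct.smul_tmul', TensorProduct.tmul_smul, ← Finset.sum_sub_distrib,
    ← Finset.sum_add_distrib]
  refine Finset.sum_congr rfl fun i _ => ?_
  module

theorem cybeForm_jordanian {κ : Type} [DecidableEq κ] {x y : κ → A}
    (rel : ExtendedRelations x y e h) :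
    cybeForm (wedge e h) (wedge e h) = 0 := by
  simp only [cybeForm, wedge, map_sub, emb12_tmul, emb13_tmul, emb23_tmul, mul_sub, sub_mul,
    Algebra.TensorProduct.tmul_mul_tmul, one_mul, mul_one, rel.ee, rel.eh, rel.he,
    TensorProduct.zero_tmul, TensorProduct.tmul_zero, TensorProduct.neg_tmul,
    TensorProduct.tmul_neg, ← TensorProduct.smul_tmul', TensorProduct.tmul_smul]
  module

theorem cybe_extendedR (rel : ExtendedRelations x y e h) : CYBE A (extendedR x y e h) := by
  have hw := rel.cybeForm_heisenberg
  have hc := rel.cybeForm_cross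
  have hj := rel.cybeForm_jordanian
  simp only [CYBE, extendedR, two_smul, map_add]
  simp only [cybeForm] at hw hc hj
  linear_combination (norm := noncomm_ring) hw + 2 * hc + 4 * hj

theorem twistPart_mul_self (rel : ExtendedRelations x y e h) :
    twistPart x y e h * twistPart x y e h = 0 := by
  simp only [twistPart, add_mul, mul_add, Finset.sum_mul, Finset.mul_sum, smul_mul_assoc,
    mul_smul_comm, Algebra.TensorProduct.tmul_mul_tmul, rel.xx, rel.ye, rel.ey, rel.ee,
    TensorProduct.zero_tmul, TensorProduct.tmul_zero, Finset.sum_const_zero, smul_zero, add_zero]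

theorem comm_twistPart_mul_twistPart (rel : ExtendedRelations x y e h) :
    Algebra.TensorProduct.comm ℂ A A (twistPart x y e h) * twistPart x y e h =
      -((Fintype.card ι + 1 : ℂ) • (e ⊗ₜ[ℂ] e)) := by
  simp only [twistPart, map_add, map_sum, map_smul, Algebra.TensorProduct.comm_tmul, add_mul,
    mul_add, Finset.sum_mul, Finset.mul_sum, smul_mul_assoc, mul_smul_comm,
    Algebra.TensorProduct.tmul_mul_tmul, rel.yx, rel.xy, rel.xe, rel.ex, rel.eh, rel.he,
    TensorProduct.zero_tmul, TensorProduct.tmul_zero, Finset.sum_const_zero, smul_zero, add_zero,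
    TensorProduct.ite_tmul, TensorProduct.tmul_ite, Finset.sum_ite_eq',
    Finset.mem_univ, if_true, TensorProduct.neg_tmul, ← TensorProduct.smul_tmul',
    TensorProduct.tmul_smul, Finset.sum_const, Finset.card_univ, ← Nat.cast_smul_eq_nsmul ℂ]
  module

theorem twistPart_mul_comm_twistPart (rel : ExtendedRelations x y e h) :
    twistPart x y e h * Algebra.TensorProduct.comm ℂ A A (twistPart x y e h) =
      -((Fintype.card ι + 1 : ℂ) • (e ⊗ₜ[ℂ] e)) := by
  simpa [tensorComm_tensorComm] using
    congrArg (Algebra.TensorProduct.comm ℂ A A) rel.comm_twistPart_mul_twistPart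

theorem extendedR_mul_self (rel : ExtendedRelations x y e h) :
    extendedR x y e h * extendedR x y e h =
      (Fintype.card ι + 1 : ℂ) • (e ⊗ₜ[ℂ] e) + (Fintype.card ι + 1 : ℂ) • (e ⊗ₜ[ℂ] e) := by
  have huu := rel.twistPart_mul_self
  have hvv := congrArg (Algebra.TensorProduct.comm ℂ A A) huu
  rw [map_mul, map_zero] at hvv
  rw [extendedR_eq_comm_sub]
  linear_combination (norm := noncomm_ring) huu + hvv - rel.comm_twistPart_mul_twistPart
    - rel.twistPart_mul_comm_twistPart

theorem triangular (rel : ExtendedRelations x y e h) {R : A ⊗[ℂ] A}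
    (hR : R = (1 + Algebra.TensorProduct.comm ℂ A A (twistPart x y e h)) *
      (1 - twistPart x y e h)) :
    R * Algebra.TensorProduct.comm ℂ A A R = 1 := by
  have huu := rel.twistPart_mul_self
  have hvv := congrArg (Algebra.TensorProduct.comm ℂ A A) huu
  rw [map_mul, map_zero] at hvv
  rw [hR, map_mul, map_add, map_sub, map_one,
    tensorComm_tensorComm]
  generalize Algebra.TensorProduct.comm ℂ A A (twistPart x y e h) = v at *
  linear_combination (norm := noncomm_ring) -hvv - (1 + v) * huu * (1 - v)

theorem yangBaxter (rel : ExtendedRelations x y e h) {R : A ⊗[ℂ] A}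
    (hR : R = (1 + Algebra.TensorProduct.comm ℂ A A (twistPart x y e h)) *
      (1 - twistPart x y e h)) :
    emb12 A R * emb13 A R * emb23 A R = emb23 A R * emb13 A R * emb12 A R := by
  have hR' : R = 1 + extendedR x y e h + (Fintype.card ι + 1 : ℂ) • (e ⊗ₜ[ℂ] e) := by
    rw [hR, extendedR_eq_comm_sub]
    linear_combination (norm := noncomm_ring) -rel.comm_twistPart_mul_twistPart
  have hsq := rel.extendedR_mul_self
  generalize (Fintype.card ι + 1 : ℂ) = n at hR' hsq
  simp only [hR', map_add, map_one]
  refine yangBaxter_of_classical (t := n • ((e ⊗ₜ[ℂ] e) ⊗ₜ[ℂ] e)) rel.cybe_extendedR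
    ?_ ?_ ?_ ?_ ?_ ?_ ?_ ?_ ?_ ?_ ?_ ?_ ?_ ?_ ?_ ?_ ?_
  iterate 3 rw [← map_mul, hsq, map_add]
  all_goals
    simp only [extendedR, wedge, map_add, map_smul, map_sum, map_sub, emb12_tmul, emb13_tmul,
      emb23_tmul, Finset.sum_mul, Finset.mul_sum, mul_sub, sub_mul, add_mul, mul_add,
      smul_mul_assoc, mul_smul_comm, Algebra.TensorProduct.tmul_mul_tmul, one_mul, mul_one,
      rel.ex, rel.ey, rel.xe, rel.ye, rel.ee, rel.eh, rel.he, TensorProduct.zero_tmul,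
      TensorProduct.tmul_zero, TensorProduct.neg_tmul, TensorProduct.tmul_neg,
      ← TensorProduct.smul_tmul', TensorProduct.tmul_smul, Finset.sum_const_zero, smul_zero,
      sub_zero]
    try module

end ExtendedRelations

end Extended

theorem eM_mul_eM (N a b c d : ℕ) :
    eM N a b * eM N c d = if b = c ∧ 1 ≤ b ∧ b ≤ 2 * N then eM N a d else 0 := by
  ext p q
  rw [Matrix.mul_apply]
  split_ifs with hb
  · obtain ⟨rfl, h1, h2⟩ := hb
    rw [Finset.sum_eq_single (⟨b - 1, by omega⟩ : Fin (2 * N))]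
    · simp only [eM, Matrix.of_apply, Nat.sub_add_cancel h1, ite_and]
      split_ifs <;> simp
    · intro k _ hk
      have : k.val + 1 ≠ b := fun h => hk (Fin.ext (by simp; omega))
      simp [eM, this]
    · simp
  · refine Finset.sum_eq_zero fun k _ => ?_
    have := k.isLt
    by_cases hk : k.val + 1 = b
    · have : k.val + 1 ≠ c := by omega
      simp [eM, this]
    · simp [eM, hk]

theorem extendedRelations_sp (N : ℕ) :
    ExtendedRelations (fun k : Fin (N - 1) => Em N 1 (2 + k)) (fun k => Ep N 1 (2 + k))
      (eM N 1 (N + 1)) (Hgen N 1) := by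
  constructor
  case xy | yx =>
    intro i j
    have := i.isLt
    have := j.isLt
    simp only [Em, Ep, mul_add, add_mul, mul_sub, sub_mul, eM_mul_eM, Fin.ext_iff]
    split_ifs <;> first | omega | simp
  case he | eh =>
    rcases Nat.eq_zero_or_pos N with rfl | hN
    · ext p
      exact p.elim0
    simp only [Hgen, smul_mul_assoc, mul_smul_comm, mul_sub, sub_mul, eM_mul_eM, true_and]
    split_ifs <;> first | omega | simp
  case ee =>
    simp only [eM_mul_eM]
    split_ifs <;> first | omega | simp
  case hx | hy =>
    intro i
    have := i.isLt
    simp only [Em, Ep, Hgen, smul_mul_assoc, mul_smul_comm, mul_add, add_mul, mul_sub, sub_mul,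
      eM_mul_eM, true_and]
    split_ifs <;> first | omega | module
  all_goals
    intro i
    try intro j
    have := i.isLt
    try have := j.isLt
    simp only [Em, Ep, mul_add, add_mul, mul_sub, sub_mul, eM_mul_eM]
    split_ifs <;> first | omega | simp

theorem List.prod_map_one_add_of_mul_eq_zero {B κ : Type*} [Ring B] (f : κ → B) (l : List κ)
    (h : ∀ i ∈ l, ∀ j ∈ l, f i * f j = 0) :
    (l.map fun i => 1 + f i).prod = 1 + (l.map f).sum := by
  induction l with
  | nil => simp
  | cons i l ih =>
    have hi : f i * (l.map f).sum = 0 := by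
      rw [← List.sum_map_mul_left]
      exact List.sum_eq_zero (by simpa using fun j hj => h i (by simp) j (by simp [hj]))
    rw [List.map_cons, List.prod_cons, List.map_cons, List.sum_cons,
      ih fun j hj k hk => h j (by simp [hj]) k (by simp [hk]), add_mul, mul_add (f i), hi]
    simp [add_assoc, add_comm]

/-- in the defining representation of `sp(N,ℂ)`, the image
`F = (1⊗1 + X_N)⋯(1⊗1 + X_2)(1⊗1 + H₁₁⊗σ)` of the full extended jordanian twist
(where `σ = 2e_{1,N+1}`, `M = 1 − e_{1,N+1}`, `X_i = E_{1−i} ⊗ (E_{1+i}M)`) is invertible,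
and `R = τ(F)·F⁻¹` satisfies the quantum Yang–Baxter equation and triangularity. -/
theorem full_extended_twist_R_matrix_QYBE (N : ℕ) (hN : 2 ≤ N)
    (σ Mm : MatN N) (hσ : σ = (2 : ℂ) • eM N 1 (N+1)) (hMm : Mm = 1 - eM N 1 (N+1))
    (X : ℕ → MatN N ⊗[ℂ] MatN N)
    (hX : ∀ i : ℕ, X i = Em N 1 i ⊗ₜ[ℂ] (Ep N 1 i * Mm))
    (F : MatN N ⊗[ℂ] MatN N)
    (hF : F = (((List.range' 2 (N-1)).reverse).map (fun i => 1 + X i)).prod *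
              (1 + Hgen N 1 ⊗ₜ[ℂ] σ)) :
    -- the "note": `E_{1+1}² = 0`, `σ = ln(1 + E_{1+1}) = E_{1+1}` and `M² = (1 + E_{1+1})⁻¹`
    Ep N 1 1 * Ep N 1 1 = 0 ∧ σ = Ep N 1 1 ∧ Mm * Mm * (1 + Ep N 1 1) = 1 ∧
    -- `F` is invertible
    IsUnit F ∧
    -- `R = τ(F)·F⁻¹` satisfies the QYBE and the triangularity condition
    (∀ R : MatN N ⊗[ℂ] MatN N,
      R = (Algebra.TensorProduct.comm ℂ (MatN N) (MatN N)) F * Ring.inverse F →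
      emb12 (MatN N) R * emb13 (MatN N) R * emb23 (MatN N) R =
        emb23 (MatN N) R * emb13 (MatN N) R * emb12 (MatN N) R ∧
      R * (Algebra.TensorProduct.comm ℂ (MatN N) (MatN N)) R = 1) := by
  have rel := extendedRelations_sp N
  set x : Fin (N - 1) → MatN N := fun k => Em N 1 (2 + k)
  set y : Fin (N - 1) → MatN N := fun k => Ep N 1 (2 + k)
  set e := eM N 1 (N + 1)
  have hE : Ep N 1 1 = (2 : ℂ) • e := by rw [two_smul, Ep]
  have hXk (k : Fin (N - 1)) : X (2 + k) = x k ⊗ₜ[ℂ] y k := by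
    rw [hX, hMm, mul_sub, mul_one, rel.ye k, sub_zero]
  have hXmem (i : ℕ) (hi : i ∈ List.range' 2 (N - 1)) :
      ∃ k : Fin (N - 1), X i = x k ⊗ₜ[ℂ] y k := by
    rw [List.mem_range'_1] at hi
    refine ⟨⟨i - 2, by omega⟩, ?_⟩
    rw [← hXk]
    congr 1
    simp only
    omega
  have hsum : ((List.range' 2 (N - 1)).reverse.map X).sum = ∑ k, x k ⊗ₜ[ℂ] y k := by
    rw [List.map_reverse, List.sum_reverse, List.range'_eq_map_range, List.map_map,
      ← Finset.sum_congr rfl fun k _ => hXk k, Fin.sum_univ_eq_sum_range (fun k => X (2 + k))]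
    rfl
  have hFu : F = 1 + twistPart x y e (Hgen N 1) := by
    rw [hF, List.prod_map_one_add_of_mul_eq_zero, hsum, hσ, TensorProduct.tmul_smul, mul_add,
      mul_one, add_mul, one_mul, Finset.sum_mul]
    · simp only [mul_smul_comm, Algebra.TensorProduct.tmul_mul_tmul, rel.ye,
        TensorProduct.tmul_zero, smul_zero, Finset.sum_const_zero, add_zero, twistPart, add_assoc]
    · intro i hi j hj
      obtain ⟨k, hk⟩ := hXmem i (List.mem_reverse.mp hi)
      obtain ⟨l, hl⟩ := hXmem j (List.mem_reverse.mp hj)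
      rw [hk, hl, Algebra.TensorProduct.tmul_mul_tmul, rel.xx, TensorProduct.zero_tmul]
  have huu := rel.twistPart_mul_self
  let U : (MatN N ⊗[ℂ] MatN N)ˣ :=
    ⟨1 + twistPart x y e (Hgen N 1), 1 - twistPart x y e (Hgen N 1),
      by rw [mul_sub, mul_one, add_mul, one_mul, huu, add_zero, add_sub_cancel_right],
      by rw [mul_add, mul_one, sub_mul, one_mul, huu, sub_zero, sub_add_cancel]⟩
  have hFU : F = U := hFu
  refine ⟨?_, by rw [hE, hσ], ?_, hFU ▸ U.isUnit, fun R hR => ?_⟩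
  · rw [hE, smul_mul_smul_comm, rel.ee, smul_zero]
  · rw [hE, hMm, two_smul]
    linear_combination (norm := noncomm_ring) (2 * e - 3) * rel.ee
  · have hR' : R = (1 + Algebra.TensorProduct.comm ℂ _ _ (twistPart x y e (Hgen N 1))) *
        (1 - twistPart x y e (Hgen N 1)) := by
      rw [hR, hFU, Ring.inverse_unit, ← hFU, hFu, map_add, map_one]
      rfl
    exact ⟨rel.yangBaxter hR', rel.triangular hR'⟩
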